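/- arXiv:2605.28789 — 2 statements merged into one kernel-verified Lean document; each statement's English description precedes it below -/
import Mathlib

section
/- Let λ₊ > λ₋ be real numbers and let κ ∈ ℝ. Define A = (κ − λ₋)/(λ₊ − λ₋), B = (λ₊ − κ)/(λ₊ − λ₋), and x : ℝ → ℂ by x(t) = A·e^{−iλ₊t} + B·e^{−iλ₋t}. Then there exists t ∈ ℝ with x(t) = 0 if and only if κ = (λ₊ + λ₋)/2 (equivalently, A = B = 1/2). -/
open Complex

/-- Zero dichotomy: `x(t) = A·e^{−iλ₊t} + B·e^{−iλ₋t}` vanishes for some real `t`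
if and only if `κ = (λ₊ + λ₋)/2` (equivalently `A = B = 1/2`). -/
theorem stmt_8 (lp lm κ : ℝ) (hlt : lm < lp)
    (A B : ℝ)
    (hA : A = (κ - lm) / (lp - lm))
    (hB : B = (lp - κ) / (lp - lm))
    (x : ℝ → ℂ)
    (hx : ∀ t : ℝ, x t = (A : ℂ) * Complex.exp (-Complex.I * lp * t)
      + (B : ℂ) * Complex.exp (-Complex.I * lm * t)) :
    (∃ t : ℝ, x t = 0) ↔ κ = (lp + lm) / 2 := by
  have hd : lp - lm ≠ 0 := (sub_pos.mpr hlt).ne'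
  constructor
  · rintro ⟨t, ht⟩
    rw [hx] at ht
    have h1 := eq_neg_of_add_eq_zero_left ht
    have n : ∀ l : ℝ, ‖Complex.exp (-Complex.I * l * t)‖ = 1 := by
      intro l
      rw [Complex.norm_exp]
      simp
    have h2 := congrArg norm h1
    rw [norm_neg, norm_mul, norm_mul, n, n, mul_one, mul_one, Complex.norm_real,
      Complex.norm_real, Real.norm_eq_abs, Real.norm_eq_abs] at h2
    have hA' : A * (lp - lm) = κ - lm := by rw [hA]; field_simp
    have hB' : B * (lp - lm) = lp - κ := by rw [hB]; field_simp
    rcases abs_eq_abs.mp h2 with h | h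
    · rw [h] at hA'
      linarith
    · rw [h] at hA'
      exfalso
      apply hd
      linarith
  · intro hκ
    have hAB : A = B := by
      rw [hA, hB, hκ]
      congr 1
      ring
    refine ⟨Real.pi / (lp - lm), ?_⟩
    have hdc : (lp : ℂ) - lm ≠ 0 := by exact_mod_cast hd
    have e : -Complex.I * lp * ((Real.pi / (lp - lm) : ℝ) : ℂ)
        = -Complex.I * lm * ((Real.pi / (lp - lm) : ℝ) : ℂ) - Real.pi * Complex.I := by
      push_cast
      field_simp
      ring
    rw [hx, e, Complex.exp_sub, Complex.exp_pi_mul_I, hAB]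
    ring
end

section
/- For every real s > 0, the limit lim_{q → 1⁻} (1 − q)^{2s+1} · ∑_{n=0}^{∞} (1 + (n + 1)²)^s · qⁿ = Γ(2s + 1) holds; that is, the function q ↦ (1 − q)^{2s+1} · ∑_{n≥0} (1 + (n+1)²)^s qⁿ tends to Γ(2s + 1) as q tends to 1 from the left within (0, 1). -/
open Filter Topology Real

open MeasureTheory in
lemma aux_tsum (F : ℕ → ℝ) (hF : IntegrableOn (fun y : ℝ => F ⌊y⌋₊) (Set.Ioi 0)) :
    ∫ y in Set.Ioi (0 : ℝ), F ⌊y⌋₊ = ∑' n, F n := by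
  have hU : (⋃ n : ℕ, Set.Ico (n : ℝ) (n + 1)) = Set.Ici 0 := by
    ext y
    simp only [Set.mem_iUnion, Set.mem_Ico, Set.mem_Ici]
    constructor
    · rintro ⟨n, h1, _⟩
      exact le_trans (Nat.cast_nonneg n) h1
    · intro hy
      exact ⟨⌊y⌋₊, Nat.floor_le hy, Nat.lt_floor_add_one y⟩
  have h := hasSum_integral_iUnion (μ := volume) (f := fun y : ℝ => F ⌊y⌋₊)
    (s := fun n : ℕ => Set.Ico (n : ℝ) (n + 1)) (fun _ => measurableSet_Ico) ?_ ?_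
  · rw [hU, integral_Ici_eq_integral_Ioi] at h
    rw [← h.tsum_eq]
    congr 1
    ext n
    rw [setIntegral_congr_fun (g := fun _ => F n) measurableSet_Ico
      (fun y hy => by simp only [Nat.floor_eq_on_Ico n y hy])]
    simp
  · intro m n hmn
    refine Set.disjoint_left.2 fun y h1 h2 => hmn ?_
    rw [← Nat.floor_eq_on_Ico m y h1, Nat.floor_eq_on_Ico n y h2]
  · rw [hU, integrableOn_Ici_iff_integrableOn_Ioi]
    exact hF

/-- The rescaled integrand. -/
noncomputable def auxPhi (s x y : ℝ) : ℝ :=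
  ((1 + ((⌊y * x⌋₊ : ℝ) + 1) ^ 2) / x ^ 2) ^ s * (1 + -1 / x) ^ ⌊y * x⌋₊

/-- The dominating function. -/
noncomputable def auxB (s y : ℝ) : ℝ :=
  exp 3 * (exp (-(y + 2)) * (y + 2) ^ (2 * s + 1 - 1))

open MeasureTheory in
lemma auxB_int (s : ℝ) (hs : 0 < s) : IntegrableOn (auxB s) (Set.Ioi 0) := by
  have h := (Real.GammaIntegral_convergent (s := 2 * s + 1) (by linarith)).mono_set
    (Set.Ioi_subset_Ioi (show (0 : ℝ) ≤ 2 by norm_num))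
  have h2 := ((measurePreserving_add_right volume (2 : ℝ)).integrableOn_comp_preimage
    (measurableEmbedding_addRight (2 : ℝ))).2 h
  have : (fun y : ℝ => y + 2) ⁻¹' Set.Ioi 2 = Set.Ioi 0 := by ext y; simp
  rw [this] at h2
  exact h2.const_mul (exp 3)

lemma auxPhi_nonneg (s x y : ℝ) (hx : 1 < x) : 0 ≤ auxPhi s x y := by
  unfold auxPhi
  have : 0 ≤ 1 + -1 / x := by
    rw [neg_div]
    have : 1 / x ≤ 1 := by rw [div_le_one (by linarith)]; linarith
    linarith
  positivity

lemma auxPhi_le (s x y : ℝ) (hs : 0 < s) (hx : 1 < x) (hy : 0 < y) :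
    auxPhi s x y ≤ auxB s y := by
  have hx0 : 0 < x := by linarith
  have h0 : 0 ≤ 1 + -1 / x := by
    rw [neg_div]
    have : 1 / x ≤ 1 := by rw [div_le_one (by linarith)]; linarith
    linarith
  have hfl : (⌊y * x⌋₊ : ℝ) ≤ y * x := Nat.floor_le (by positivity)
  have hfl2 : y * x < (⌊y * x⌋₊ : ℝ) + 1 := Nat.lt_floor_add_one _
  have hn : (0 : ℝ) ≤ ⌊y * x⌋₊ := Nat.cast_nonneg _
  have h1 : ((1 + ((⌊y * x⌋₊ : ℝ) + 1) ^ 2) / x ^ 2) ^ s ≤ (y + 2) ^ (2 * s) := by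
    rw [Real.rpow_mul (by linarith)]
    refine Real.rpow_le_rpow (by positivity) ?_ hs.le
    rw [div_le_iff₀ (by positivity), Real.rpow_two]
    have : ((⌊y * x⌋₊ : ℝ) + 1) ^ 2 ≤ (y * x + x) ^ 2 := by
      apply pow_le_pow_left₀ (by positivity); linarith
    nlinarith [mul_pos hy hx0, mul_pos hy (mul_pos hx0 hx0)]
  have h2 : (1 + -1 / x) ^ ⌊y * x⌋₊ ≤ exp (1 - y) := by
    calc (1 + -1 / x) ^ ⌊y * x⌋₊ ≤ (exp (-1 / x)) ^ ⌊y * x⌋₊ := by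
          apply pow_le_pow_left₀ h0
          linarith [Real.add_one_le_exp (-1 / x)]
      _ = exp (⌊y * x⌋₊ * (-1 / x)) := by rw [Real.exp_nat_mul]
      _ ≤ exp (1 - y) := by
          apply Real.exp_le_exp.2
          rw [mul_div_assoc', div_le_iff₀ hx0]
          nlinarith
  have h3 : auxB s y = (y + 2) ^ (2 * s) * exp (1 - y) := by
    unfold auxB
    rw [← mul_assoc, ← Real.exp_add, mul_comm]
    congr 2 <;> ring
  rw [h3]
  unfold auxPhi
  exact mul_le_mul h1 h2 (by positivity) (by positivity)

lemma auxPhi_meas (s x : ℝ) : Measurable (auxPhi s x) := by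
  have : auxPhi s x = (fun n : ℕ => ((1 + ((n : ℝ) + 1) ^ 2) / x ^ 2) ^ s * (1 + -1 / x) ^ n) ∘
    (fun y : ℝ => ⌊y * x⌋₊) := rfl
  rw [this]
  exact (measurable_from_nat).comp (Nat.measurable_floor.comp (measurable_id.mul_const x))

lemma auxPhi_tendsto (s y : ℝ) (hs : 0 < s) (hy : 0 < y) :
    Tendsto (fun x => auxPhi s x y) atTop (𝓝 (exp (-y) * y ^ (2 * s + 1 - 1))) := by
  have h1 := tendsto_nat_floor_mul_div_atTop (R := ℝ) hy.le
  have h2 := Real.tendsto_mul_log_one_add_div_atTop (-1)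
  have h3 := (Real.continuous_exp.tendsto _).comp (h1.mul h2)
  have h4 : Tendsto (fun x : ℝ => x⁻¹) atTop (𝓝 0) := tendsto_inv_atTop_zero
  have h5 := ((h4.pow 2).add ((h1.add h4).pow 2)).rpow_const (p := s) (Or.inr hs.le)
  have h6 := h5.mul h3
  have e : (0 ^ 2 + (y + 0) ^ 2) ^ s * exp (y * -1) = exp (-y) * y ^ (2 * s + 1 - 1) := by
    rw [mul_comm, mul_neg_one, add_zero, add_sub_cancel_right, Real.rpow_mul hy.le, Real.rpow_two]
    simp
  rw [e] at h6
  refine h6.congr' ?_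
  filter_upwards [eventually_gt_atTop 1] with x hx
  have hx0 : 0 < x := by linarith
  have h0 : 0 < 1 + -1 / x := by
    rw [neg_div]
    have : 1 / x < 1 := by rw [div_lt_one (by linarith)]; linarith
    linarith
  unfold auxPhi
  congr 1
  · congr 1
    field_simp
  · simp only [Function.comp]
    rw [← mul_assoc, div_mul_cancel₀ _ hx0.ne', Real.exp_nat_mul, Real.exp_log h0]

open MeasureTheory in
lemma aux_int (s x : ℝ) (hs : 0 < s) (hx : 1 < x) : IntegrableOn (auxPhi s x) (Set.Ioi 0) := by
  refine Integrable.mono' (auxB_int s hs) (auxPhi_meas s x).aestronglyMeasurable ?_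
  filter_upwards [ae_restrict_mem measurableSet_Ioi] with y hy
  rw [Real.norm_of_nonneg (auxPhi_nonneg s x y hx)]
  exact auxPhi_le s x y hs hx hy

open MeasureTheory in
lemma aux_lim (s : ℝ) (hs : 0 < s) :
    Tendsto (fun x => ∫ y in Set.Ioi 0, auxPhi s x y) atTop (𝓝 (Real.Gamma (2 * s + 1))) := by
  rw [Real.Gamma_eq_integral (by linarith)]
  refine tendsto_integral_filter_of_dominated_convergence (auxB s) ?_ ?_ (auxB_int s hs) ?_
  · exact Eventually.of_forall fun x => (auxPhi_meas s x).aestronglyMeasurable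
  · filter_upwards [eventually_gt_atTop 1] with x hx
    filter_upwards [ae_restrict_mem measurableSet_Ioi] with y hy
    rw [Real.norm_of_nonneg (auxPhi_nonneg s x y hx)]
    exact auxPhi_le s x y hs hx hy
  · filter_upwards [ae_restrict_mem measurableSet_Ioi] with y hy
    exact auxPhi_tendsto s y hs hy

open MeasureTheory in
lemma aux_eq (s x : ℝ) (hs : 0 < s) (hx : 1 < x) :
    ∫ y in Set.Ioi 0, auxPhi s x y = x⁻¹ ^ (2 * s + 1) *
      ∑' n : ℕ, (1 + ((n : ℝ) + 1) ^ 2) ^ s * (1 + -1 / x) ^ n := by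
  have hx0 : 0 < x := by linarith
  set F : ℕ → ℝ := fun n => ((1 + ((n : ℝ) + 1) ^ 2) / x ^ 2) ^ s * (1 + -1 / x) ^ n with hF
  have hi := (integrableOn_Ioi_comp_mul_right_iff (fun y : ℝ => F ⌊y⌋₊) 0 hx0).1
    (aux_int s x hs hx)
  have he := integral_comp_mul_right_Ioi (fun y : ℝ => F ⌊y⌋₊) 0 hx0
  rw [zero_mul] at hi he
  rw [aux_tsum F hi] at he
  refine he.trans ?_
  rw [smul_eq_mul, ← tsum_mul_left, ← tsum_mul_left]
  congr 1
  ext n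
  rw [hF]
  simp only
  rw [Real.rpow_add (by positivity), Real.rpow_one, Real.rpow_mul (by positivity), Real.rpow_two,
    div_eq_mul_inv _ (x ^ 2), Real.mul_rpow (by positivity) (by positivity), inv_pow]
  ring

/-- Abelian asymptotic: `(1−q)^{2s+1} ∑_{n≥0} (1+(n+1)²)^s qⁿ → Γ(2s+1)` as
`q → 1⁻` within `(0,1)`. -/
theorem stmt_18 (s : ℝ) (hs : 0 < s) :
    Tendsto
      (fun q : ℝ => (1 - q) ^ (2 * s + 1) *
        ∑' n : ℕ, (1 + ((n : ℝ) + 1) ^ 2) ^ s * q ^ n)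
      (nhdsWithin 1 (Set.Ioo (0 : ℝ) 1))
      (nhds (Real.Gamma (2 * s + 1))) := by
  have h1 : Tendsto (fun q : ℝ => (1 - q)⁻¹) (nhdsWithin 1 (Set.Ioo (0 : ℝ) 1)) atTop := by
    refine tendsto_inv_nhdsGT_zero.comp (tendsto_nhdsWithin_iff.2 ⟨?_, ?_⟩)
    · have : Tendsto (fun q : ℝ => 1 - q) (𝓝 1) (𝓝 (1 - 1)) := tendsto_const_nhds.sub tendsto_id
      rw [sub_self] at this
      exact this.mono_left nhdsWithin_le_nhds
    · filter_upwards [self_mem_nhdsWithin] with q hq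
      exact sub_pos.2 hq.2
  refine ((aux_lim s hs).comp h1).congr' ?_
  filter_upwards [self_mem_nhdsWithin] with q hq
  have hq1 : 0 < 1 - q := sub_pos.2 hq.2
  have hq2 : 1 < (1 - q)⁻¹ := (one_lt_inv₀ hq1).2 (by linarith [hq.1])
  have hq3 : 1 + -1 / (1 - q)⁻¹ = q := by rw [div_inv_eq_mul]; ring
  simp only [Function.comp]
  rw [aux_eq s _ hs hq2, inv_inv, hq3]
end
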